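/- Suppose F = (F₁, F₂) : ℝ² → ℝ² is twice continuously differentiable on a bounded smooth domain D with boundary Γ, and define φ(x) = −∫_D G_L(x−y)(∇·F)(y) dy + ∫_Γ G_L(x−y)(ν(y)·F(y)) ds(y) and ψ(x) = ∫_D G_L(x−y)(∂F₂/∂x₁ − ∂F₁/∂x₂)(y) dy − ∫_Γ G_L(x−y)(τ(y)·F(y)) ds(y), where G_L(x) = −(1/2π)ln|x|. Then F = ∇^⊥ψ + ∇φ in D, where ∇^⊥ψ = (∂ψ/∂x₂, −∂ψ/∂x₁). -/

import Mathlib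

open Real MeasureTheory

/-- Partial derivative in the first coordinate of a function on `ℝ²`. -/
noncomputable def pdx (f : ℝ × ℝ → ℝ) (x : ℝ × ℝ) : ℝ := deriv (fun a => f (a, x.2)) x.1

/-- Partial derivative in the second coordinate of a function on `ℝ²`. -/
noncomputable def pdy (f : ℝ × ℝ → ℝ) (x : ℝ × ℝ) : ℝ := deriv (fun b => f (x.1, b)) x.2

/-- The Laplace fundamental solution in `ℝ²`, `G_L(x) = -(1/2π) ln|x|` (Euclidean norm). -/
noncomputable def GL2 (x : ℝ × ℝ) : ℝ :=
  -(1 / (2 * π)) * Real.log (Real.sqrt (x.1 ^ 2 + x.2 ^ 2))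


open Set Filter Topology

/-- first partial of GL2 -/
noncomputable def GA (z : ℝ × ℝ) : ℝ := -(1 / (2 * π)) * (z.1 / (z.1 ^ 2 + z.2 ^ 2))
/-- second partial of GL2 -/
noncomputable def GB (z : ℝ × ℝ) : ℝ := -(1 / (2 * π)) * (z.2 / (z.1 ^ 2 + z.2 ^ 2))

/-- directional derivative kernel -/
noncomputable def dG (e z : ℝ × ℝ) : ℝ := GA z * e.1 + GB z * e.2

lemma sq_pos_of_ne {z : ℝ × ℝ} (hz : z ≠ 0) : 0 < z.1 ^ 2 + z.2 ^ 2 := by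
  by_contra h
  apply hz
  have h1 : z.1 = 0 := by nlinarith [sq_nonneg z.1, sq_nonneg z.2]
  have h2 : z.2 = 0 := by nlinarith [sq_nonneg z.1, sq_nonneg z.2]
  exact Prod.ext h1 h2

lemma GL2_eq (z : ℝ × ℝ) : GL2 z = -(1 / (2 * π)) * (Real.log (z.1 ^ 2 + z.2 ^ 2) / 2) := by
  unfold GL2
  rw [Real.log_sqrt (by positivity)]

lemma contDiffAt_GL2 {z : ℝ × ℝ} (hz : z ≠ 0) {n : WithTop ℕ∞} : ContDiffAt ℝ n GL2 z := by
  have : GL2 = fun z : ℝ × ℝ => -(1 / (2 * π)) * (Real.log (z.1 ^ 2 + z.2 ^ 2) / 2) :=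
    funext GL2_eq
  rw [this]
  have h := sq_pos_of_ne hz
  have h1 : ContDiffAt ℝ n (fun z : ℝ × ℝ => z.1 ^ 2 + z.2 ^ 2) z := by fun_prop
  exact contDiffAt_const.mul ((h1.log h.ne').div_const 2)

lemma contDiffAt_dG (e : ℝ × ℝ) {z : ℝ × ℝ} (hz : z ≠ 0) {n : WithTop ℕ∞} :
    ContDiffAt ℝ n (dG e) z := by
  have h := sq_pos_of_ne hz
  have h1 : ContDiffAt ℝ n (fun z : ℝ × ℝ => z.1 ^ 2 + z.2 ^ 2) z := by fun_prop
  unfold dG GA GB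
  exact ((contDiffAt_const.mul (contDiffAt_fst.div h1 h.ne')).mul contDiffAt_const).add
    ((contDiffAt_const.mul (contDiffAt_snd.div h1 h.ne')).mul contDiffAt_const)

lemma hasFDerivAt_sq (z : ℝ × ℝ) : HasFDerivAt (fun z : ℝ × ℝ => z.1 ^ 2 + z.2 ^ 2)
    ((2 * z.1) • ContinuousLinearMap.fst ℝ ℝ ℝ + (2 * z.2) • ContinuousLinearMap.snd ℝ ℝ ℝ) z := by
  have h1 : HasFDerivAt (fun z : ℝ × ℝ => z.1) (ContinuousLinearMap.fst ℝ ℝ ℝ) z := hasFDerivAt_fst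
  have h2 : HasFDerivAt (fun z : ℝ × ℝ => z.2) (ContinuousLinearMap.snd ℝ ℝ ℝ) z := hasFDerivAt_snd
  refine HasFDerivAt.congr_fderiv ((h1.pow 2).add (h2.pow 2)) ?_
  ext <;> simp

lemma fderiv_GL2 {z : ℝ × ℝ} (hz : z ≠ 0) (e : ℝ × ℝ) : fderiv ℝ GL2 z e = dG e z := by
  have h := sq_pos_of_ne hz
  have : GL2 = fun z : ℝ × ℝ => -(1 / (2 * π)) * (Real.log (z.1 ^ 2 + z.2 ^ 2) * (1 / 2)) := by
    funext z; rw [GL2_eq]; ring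
  rw [this, ((((hasFDerivAt_sq z).log h.ne').mul_const (1 / 2)).const_mul (-(1 / (2 * π)))).fderiv]
  simp [dG, GA, GB]
  field_simp

lemma dG_symm (e e' : ℝ × ℝ) {z : ℝ × ℝ} (hz : z ≠ 0) :
    fderiv ℝ (dG e) z e' = fderiv ℝ (dG e') z e := by
  have key : ∀ e e' : ℝ × ℝ, fderiv ℝ (dG e) z e' = fderiv ℝ (fderiv ℝ GL2) z e' e := by
    intro e e'
    have h1 : dG e =ᶠ[𝓝 z] fun w => fderiv ℝ GL2 w e := by
      filter_upwards [isOpen_ne.mem_nhds hz] with w hw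
      exact (fderiv_GL2 hw e).symm
    rw [h1.fderiv_eq]
    have h2 : DifferentiableAt ℝ (fderiv ℝ GL2) z :=
      ((contDiffAt_GL2 hz (n := 2)).fderiv_right (m := 1) (by norm_num)).differentiableAt (by norm_num)
    rw [fderiv_clm_apply h2 (differentiableAt_const e)]
    simp
  rw [key, key]
  exact ((contDiffAt_GL2 hz (n := 2)).isSymmSndFDerivAt (by simp)) _ _

lemma dG_trace {z : ℝ × ℝ} (hz : z ≠ 0) :
    fderiv ℝ (dG (1, 0)) z (1, 0) + fderiv ℝ (dG (0, 1)) z (0, 1) = 0 := by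
  have h := sq_pos_of_ne hz
  have hs := hasFDerivAt_sq z
  have h1 : HasFDerivAt (fun z : ℝ × ℝ => z.1) (ContinuousLinearMap.fst ℝ ℝ ℝ) z := hasFDerivAt_fst
  have h2 : HasFDerivAt (fun z : ℝ × ℝ => z.2) (ContinuousLinearMap.snd ℝ ℝ ℝ) z := hasFDerivAt_snd
  have e1 : dG (1, 0) = fun z : ℝ × ℝ => -(1 / (2 * π)) * (z.1 / (z.1 ^ 2 + z.2 ^ 2)) := by
    funext z; simp [dG, GA]
  have e2 : dG (0, 1) = fun z : ℝ × ℝ => -(1 / (2 * π)) * (z.2 / (z.1 ^ 2 + z.2 ^ 2)) := by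
    funext z; simp [dG, GB]
  have hi : HasFDerivAt (fun z : ℝ × ℝ => (z.1 ^ 2 + z.2 ^ 2)⁻¹) _ z :=
    (hasDerivAt_inv h.ne').comp_hasFDerivAt z hs
  have d1 := (h1.mul hi).const_mul (-(1 / (2 * π)))
  have d2 := (h2.mul hi).const_mul (-(1 / (2 * π)))
  rw [e1, e2]
  simp only [div_eq_mul_inv (_ : ℝ) (_ ^ 2 + _ ^ 2)]
  erw [d1.fderiv, d2.fderiv]
  simp
  field_simp
  ring

lemma measurable_GL2 : Measurable GL2 := by
  unfold GL2
  fun_prop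

lemma measurable_dG (e : ℝ × ℝ) : Measurable (dG e) := by
  unfold dG GA GB
  fun_prop

/-- auxiliary majorant -/
noncomputable def maj (z : ℝ × ℝ) : ℝ := |z.1| ^ (-(1/2) : ℝ) * |z.2| ^ (-(1/2) : ℝ)

lemma intervalIntegrable_abs_rpow (a b : ℝ) :
    IntervalIntegrable (fun x : ℝ => |x| ^ (-(1/2) : ℝ)) volume a b := by
  apply intervalIntegrable_of_even (fun x => by simp)
  intro x hx
  have h := intervalIntegral.intervalIntegrable_rpow' (a := 0) (b := x) (r := -(1/2)) (by norm_num)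
  refine h.congr ?_
  intro y hy
  rw [uIoc_of_le hx.le] at hy
  simp only
  rw [abs_of_pos hy.1]

lemma locallyIntegrable_maj : LocallyIntegrable maj := by
  rw [locallyIntegrable_iff]
  intro k hk
  obtain ⟨R, hR⟩ := hk.isBounded.subset_closedBall 0
  have h1 : IntegrableOn (fun x : ℝ => |x| ^ (-(1/2) : ℝ)) (Icc (-R) R) := by
    by_cases h : -R ≤ R
    · exact (intervalIntegrable_iff_integrableOn_Icc_of_le h).1 (intervalIntegrable_abs_rpow _ _)
    · rw [Icc_eq_empty h]; exact integrableOn_empty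
  have h2 : IntegrableOn maj (Icc (-R) R ×ˢ Icc (-R) R) := by
    unfold IntegrableOn at *
    rw [Measure.volume_eq_prod, ← Measure.prod_restrict]
    exact h1.mul_prod h1
  refine h2.mono_set (hR.trans ?_)
  intro z hz
  have hz' : ‖z‖ ≤ R := by simpa using hz
  have ha := (norm_fst_le z).trans hz'
  have hb := (norm_snd_le z).trans hz'
  rw [Real.norm_eq_abs, abs_le] at ha hb
  exact ⟨ha, hb⟩

lemma ae_ne_zero : ∀ᵐ z : ℝ × ℝ, z.1 ≠ 0 ∧ z.2 ≠ 0 := by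
  have h0 : ∀ᵐ x : ℝ, x ≠ 0 := by
    simp [ae_iff, measure_singleton]
  have h1 : ∀ᵐ z : ℝ × ℝ, z.1 ≠ 0 := Measure.quasiMeasurePreserving_fst.ae h0
  have h2 : ∀ᵐ z : ℝ × ℝ, z.2 ≠ 0 := Measure.quasiMeasurePreserving_snd.ae h0
  filter_upwards [h1, h2] with z a b using ⟨a, b⟩

lemma inv_sqrt_le_maj {z : ℝ × ℝ} (h1 : z.1 ≠ 0) (h2 : z.2 ≠ 0) :
    (√(z.1 ^ 2 + z.2 ^ 2))⁻¹ ≤ maj z := by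
  have a1 : 0 < |z.1| := abs_pos.2 h1
  have a2 : 0 < |z.2| := abs_pos.2 h2
  unfold maj
  rw [← Real.mul_rpow a1.le a2.le, Real.rpow_neg (by positivity), ← Real.sqrt_eq_rpow]
  apply inv_anti₀ (by positivity)
  apply Real.sqrt_le_sqrt
  nlinarith [sq_abs z.1, sq_abs z.2, sq_nonneg (|z.1| - |z.2|)]

lemma locallyIntegrable_dG (e : ℝ × ℝ) : LocallyIntegrable (dG e) := by
  have h := locallyIntegrable_maj.smul (|e.1| + |e.2|)
  refine h.mono (measurable_dG e).aestronglyMeasurable ?_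
  filter_upwards [ae_ne_zero] with z hz
  have hz0 : z ≠ 0 := fun h => hz.1 (by rw [h]; rfl)
  have hp := sq_pos_of_ne hz0
  have hm := inv_sqrt_le_maj hz.1 hz.2
  set r := √(z.1 ^ 2 + z.2 ^ 2) with hr
  have hr0 : 0 < r := Real.sqrt_pos.2 hp
  have hr2 : z.1 ^ 2 + z.2 ^ 2 = r ^ 2 := (Real.sq_sqrt hp.le).symm
  have b1 : |z.1| ≤ r := Real.abs_le_sqrt (by nlinarith [sq_nonneg z.2])
  have b2 : |z.2| ≤ r := Real.abs_le_sqrt (by nlinarith [sq_nonneg z.1])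
  have hpi : 1 / (2 * π) ≤ 1 := by
    rw [div_le_one (by positivity)]
    linarith [Real.pi_gt_three]
  have key : ∀ t : ℝ, |t| ≤ r → |-(1 / (2 * π)) * (t / r ^ 2)| ≤ r⁻¹ := by
    intro t ht
    rw [abs_mul, abs_neg, abs_of_pos (by positivity : 0 < 1 / (2 * π)), abs_div,
      abs_of_pos (by positivity : 0 < r ^ 2)]
    calc 1 / (2 * π) * (|t| / r ^ 2) ≤ 1 * (r / r ^ 2) := by gcongr
      _ = r⁻¹ := by field_simp
  have k1 := key _ b1
  have k2 := key _ b2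
  have hm0 : 0 < r⁻¹ := by positivity
  simp only [Pi.smul_apply, smul_eq_mul]
  unfold dG GA GB
  rw [hr2, Real.norm_eq_abs, Real.norm_eq_abs]
  calc _ ≤ |-(1 / (2 * π)) * (z.1 / r ^ 2) * e.1| + |-(1 / (2 * π)) * (z.2 / r ^ 2) * e.2| :=
        abs_add_le _ _
    _ = |-(1 / (2 * π)) * (z.1 / r ^ 2)| * |e.1| + |-(1 / (2 * π)) * (z.2 / r ^ 2)| * |e.2| := by
        rw [abs_mul, abs_mul _ e.2]
    _ ≤ r⁻¹ * |e.1| + r⁻¹ * |e.2| := by gcongr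
    _ ≤ maj z * |e.1| + maj z * |e.2| := by gcongr
    _ = (|e.1| + |e.2|) * maj z := by ring
    _ ≤ _ := le_abs_self _

lemma locallyIntegrable_GL2 : LocallyIntegrable GL2 := by
  have hc : LocallyIntegrable (fun z : ℝ × ℝ => √(z.1 ^ 2 + z.2 ^ 2)) :=
    Continuous.locallyIntegrable (by fun_prop)
  have h := hc.add locallyIntegrable_maj
  refine h.mono measurable_GL2.aestronglyMeasurable ?_
  filter_upwards [ae_ne_zero] with z hz
  have hz0 : z ≠ 0 := fun h => hz.1 (by rw [h]; rfl)
  have hp := sq_pos_of_ne hz0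
  have hm := inv_sqrt_le_maj hz.1 hz.2
  simp only [Pi.add_apply]
  unfold GL2
  set r := √(z.1 ^ 2 + z.2 ^ 2) with hr
  have hr0 : 0 < r := Real.sqrt_pos.2 hp
  have hpi : 1 / (2 * π) ≤ 1 := by
    rw [div_le_one (by positivity)]
    linarith [Real.pi_gt_three]
  have hri : 0 < r⁻¹ := by positivity
  have l1 := Real.log_le_sub_one_of_pos hr0
  have l2 := Real.log_le_sub_one_of_pos hri
  rw [Real.log_inv] at l2
  have hl : |Real.log r| ≤ r + maj z := abs_le.2 ⟨by linarith, by linarith⟩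
  rw [Real.norm_eq_abs, Real.norm_eq_abs, abs_mul, abs_neg,
    abs_of_pos (by positivity : 0 < 1 / (2 * π))]
  calc _ ≤ 1 * (r + maj z) := by gcongr
    _ ≤ _ := by rw [one_mul]; exact le_abs_self _

lemma hasDerivAt_line {k : ℝ × ℝ → ℝ} (p v : ℝ × ℝ) (t : ℝ) (hk : DifferentiableAt ℝ k (p + t • v)) :
    HasDerivAt (fun t : ℝ => k (p + t • v)) (fderiv ℝ k (p + t • v) v) t := by
  have h1 : HasDerivAt (fun t : ℝ => p + t • v) v t := by
    simpa using ((hasDerivAt_id t).smul_const v).const_add p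
  exact hk.hasFDerivAt.comp_hasDerivAt t h1

lemma integrable_mul_of_compact {f k : ℝ × ℝ → ℝ} (hf : LocallyIntegrable f) (hk : Continuous k)
    (hc : HasCompactSupport k) : Integrable (fun y => f y * k y) := by
  simpa using hf.integrable_smul_right_of_hasCompactSupport hk hc

lemma ibp_aux {k : ℝ × ℝ → ℝ} (hk : ContDiff ℝ 1 k) (hc : HasCompactSupport k) (e : ℝ × ℝ) :
    Integrable (fun y => GL2 y * fderiv ℝ k y e + dG e y * k y) := by
  have h1 : Continuous (fun y => fderiv ℝ k y e) :=
    (hk.continuous_fderiv (by norm_num)).clm_apply continuous_const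
  have h2 : HasCompactSupport (fun y => fderiv ℝ k y e) := hc.fderiv_apply ℝ e
  exact (integrable_mul_of_compact locallyIntegrable_GL2 h1 h2).add
    (integrable_mul_of_compact (locallyIntegrable_dG e) hk.continuous hc)

lemma ibp_line {k : ℝ × ℝ → ℝ} (hk : ContDiff ℝ 1 k) (hc : HasCompactSupport k) (p e : ℝ × ℝ)
    (he : e ≠ 0) (hp : ∀ t : ℝ, p + t • e ≠ 0) :
    ∫ t : ℝ, (GL2 (p + t • e) * fderiv ℝ k (p + t • e) e + dG e (p + t • e) * k (p + t • e)) = 0 := by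
  have hl : Continuous (fun t : ℝ => p + t • e) := by fun_prop
  have hemb : Topology.IsClosedEmbedding (fun t : ℝ => p + t • e) :=
    (Homeomorph.addLeft p).isClosedEmbedding.comp (isClosedEmbedding_smul_left he)
  have hk' : HasCompactSupport (fun t : ℝ => k (p + t • e)) := hc.comp_isClosedEmbedding hemb
  have hdk' : HasCompactSupport (fun t : ℝ => fderiv ℝ k (p + t • e) e) :=
    (hc.fderiv_apply ℝ e).comp_isClosedEmbedding hemb
  have cG : Continuous (fun t : ℝ => GL2 (p + t • e)) :=
    continuous_iff_continuousAt.2 fun t =>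
      ContinuousAt.comp (g := GL2) (contDiffAt_GL2 (n := 1) (hp t)).continuousAt hl.continuousAt
  have cdG : Continuous (fun t : ℝ => dG e (p + t • e)) :=
    continuous_iff_continuousAt.2 fun t =>
      ContinuousAt.comp (g := dG e) (contDiffAt_dG e (n := 1) (hp t)).continuousAt hl.continuousAt
  have ck : Continuous (fun t : ℝ => k (p + t • e)) := hk.continuous.comp hl
  have cdk : Continuous (fun t : ℝ => fderiv ℝ k (p + t • e) e) :=
    ((hk.continuous_fderiv (by norm_num)).clm_apply continuous_const).comp hl
  refine integral_eq_zero_of_hasDerivAt_of_integrable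
    (f := fun t => GL2 (p + t • e) * k (p + t • e)) ?_ ?_ ?_
  · intro t
    have h1 := hasDerivAt_line p e t ((contDiffAt_GL2 (n := 1) (hp t)).differentiableAt (by norm_num))
    have h2 := hasDerivAt_line p e t (hk.contDiffAt.differentiableAt (by norm_num))
    rw [fderiv_GL2 (hp t)] at h1
    refine (h1.mul h2).congr_deriv ?_
    ring
  · exact ((cG.mul cdk).integrable_of_hasCompactSupport hdk'.mul_left).add
      ((cdG.mul ck).integrable_of_hasCompactSupport hk'.mul_left)
  · exact (cG.mul ck).integrable_of_hasCompactSupport hk'.mul_left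

lemma ibp1 {k : ℝ × ℝ → ℝ} (hk : ContDiff ℝ 1 k) (hc : HasCompactSupport k) :
    ∫ y, (GL2 y * fderiv ℝ k y (1, 0) + dG (1, 0) y * k y) = 0 := by
  have hi := ibp_aux hk hc (1, 0)
  rw [Measure.volume_eq_prod] at hi ⊢
  rw [integral_prod_symm _ hi]
  apply integral_eq_zero_of_ae
  have h0 : ∀ᵐ x : ℝ, x ≠ 0 := by simp [ae_iff, measure_singleton]
  filter_upwards [h0] with b hb
  have := ibp_line hk hc (0, b) (1, 0) (by simp) (by intro t; simp [hb])
  simpa using this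

lemma ibp2 {k : ℝ × ℝ → ℝ} (hk : ContDiff ℝ 1 k) (hc : HasCompactSupport k) :
    ∫ y, (GL2 y * fderiv ℝ k y (0, 1) + dG (0, 1) y * k y) = 0 := by
  have hi := ibp_aux hk hc (0, 1)
  rw [Measure.volume_eq_prod] at hi ⊢
  rw [integral_prod _ hi]
  apply integral_eq_zero_of_ae
  have h0 : ∀ᵐ x : ℝ, x ≠ 0 := by simp [ae_iff, measure_singleton]
  filter_upwards [h0] with b hb
  have := ibp_line hk hc (b, 0) (0, 1) (by simp) (by intro t; simp [hb])
  simpa using this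

lemma radial {h : ℝ × ℝ → ℝ} (hh : ContDiff ℝ 1 h) (hc : HasCompactSupport h) :
    ∫ y, (dG (1, 0) y * fderiv ℝ h y (1, 0) + dG (0, 1) y * fderiv ℝ h y (0, 1)) = h 0 := by
  set g : ℝ × ℝ → ℝ := fun p =>
    fderiv ℝ h ((0 : ℝ × ℝ) + p.1 • (Real.cos p.2, Real.sin p.2)) (Real.cos p.2, Real.sin p.2) with hg
  have hgc : Continuous g := by
    have : Continuous (fderiv ℝ h) := hh.continuous_fderiv (by norm_num)
    exact (this.comp (by fun_prop)).clm_apply (by fun_prop)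
  obtain ⟨R, hR⟩ := hc.isBounded.subset_closedBall 0
  have hout : ∀ r : ℝ, 2 * |R| + 1 ≤ r → ∀ θ : ℝ,
      (0 : ℝ × ℝ) + r • (Real.cos θ, Real.sin θ) ∉ tsupport h := by
    intro r hr θ hmem
    have h1 := hR hmem
    rw [mem_closedBall_zero_iff] at h1
    have ha := (norm_fst_le _).trans h1
    have hb := (norm_snd_le _).trans h1
    simp only [zero_add, Prod.smul_fst, Prod.smul_snd, smul_eq_mul, Real.norm_eq_abs] at ha hb
    have hR0 : R ≤ |R| := le_abs_self R
    have hR1 : 0 ≤ |R| := abs_nonneg R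
    have h2 : r ^ 2 ≤ 2 * R ^ 2 := by
      have h3 := sq_le_sq' (by linarith [abs_nonneg (r * Real.cos θ)]) ha
      have h4 := sq_le_sq' (by linarith [abs_nonneg (r * Real.sin θ)]) hb
      rw [sq_abs] at h3 h4
      have : r ^ 2 = (r * Real.cos θ) ^ 2 + (r * Real.sin θ) ^ 2 := by
        linear_combination (-r ^ 2) * Real.cos_sq_add_sin_sq θ
      linarith
    nlinarith [sq_abs R]
  set M := 2 * |R| + 1 with hM
  have hgz : ∀ r : ℝ, M ≤ r → ∀ θ : ℝ, g (r, θ) = 0 := by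
    intro r hr θ
    have : (0 : ℝ × ℝ) + r • (Real.cos θ, Real.sin θ) ∉ tsupport (fderiv ℝ h) :=
      fun hx => hout r hr θ (tsupport_fderiv_subset ℝ hx)
    simp only [hg]
    rw [image_eq_zero_of_notMem_tsupport this]
    rfl
  have hgi : IntegrableOn g (Ioi 0 ×ˢ Ioo (-π) π) := by
    have h1 : IntegrableOn g (Icc 0 M ×ˢ Icc (-π) π) :=
      hgc.continuousOn.integrableOn_compact (isCompact_Icc.prod isCompact_Icc)
    refine h1.of_forall_sdiff_eq_zero (measurableSet_Ioi.prod measurableSet_Ioo) ?_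
    rintro ⟨r, θ⟩ ⟨⟨h2, h3⟩, h4⟩
    apply hgz
    by_contra hlt
    exact h4 ⟨⟨le_of_lt h2, (not_le.1 hlt).le⟩, ⟨h3.1.le, h3.2.le⟩⟩
  have hinner : ∀ θ : ℝ, ∫ r in Ioi (0 : ℝ), g (r, θ) = - h 0 := by
    intro θ
    have e0 : (Real.cos θ, Real.sin θ) ≠ (0 : ℝ × ℝ) := by
      intro h0
      have h1 : Real.cos θ = 0 := congrArg Prod.fst h0
      have h2 : Real.sin θ = 0 := congrArg Prod.snd h0
      have := Real.cos_sq_add_sin_sq θ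
      rw [h1, h2] at this
      norm_num at this
    have hemb : Topology.IsClosedEmbedding
        (fun t : ℝ => (0 : ℝ × ℝ) + t • (Real.cos θ, Real.sin θ)) :=
      (Homeomorph.addLeft 0).isClosedEmbedding.comp (isClosedEmbedding_smul_left e0)
    have h1 := HasCompactSupport.integral_Ioi_deriv_eq
      (f := fun t : ℝ => h ((0 : ℝ × ℝ) + t • (Real.cos θ, Real.sin θ)))
      (hh.comp (by fun_prop)) (hc.comp_isClosedEmbedding hemb) 0
    have h2 : deriv (fun t : ℝ => h ((0 : ℝ × ℝ) + t • (Real.cos θ, Real.sin θ)))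
        = fun r => g (r, θ) := by
      funext r
      exact (hasDerivAt_line 0 _ r (hh.contDiffAt.differentiableAt (by norm_num))).deriv
    rw [h2] at h1
    simpa using h1
  rw [← integral_comp_polarCoord_symm]
  have h1 : ∫ p in polarCoord.target, p.1 • ((fun y => dG (1, 0) y * fderiv ℝ h y (1, 0) +
      dG (0, 1) y * fderiv ℝ h y (0, 1)) (polarCoord.symm p)) =
      ∫ p in Ioi (0 : ℝ) ×ˢ Ioo (-π) π, -(1 / (2 * π)) * g p := by
    apply setIntegral_congr_fun (measurableSet_Ioi.prod measurableSet_Ioo)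
    rintro ⟨r, θ⟩ ⟨hr, -⟩
    have hr : 0 < r := hr
    have hs : (r * Real.cos θ) ^ 2 + (r * Real.sin θ) ^ 2 = r ^ 2 := by
      linear_combination (r ^ 2) * Real.cos_sq_add_sin_sq θ
    have hv : ((Real.cos θ, Real.sin θ) : ℝ × ℝ)
        = Real.cos θ • ((1, 0) : ℝ × ℝ) + Real.sin θ • ((0, 1) : ℝ × ℝ) := by simp
    have hgv : g (r, θ) = Real.cos θ * fderiv ℝ h (r * Real.cos θ, r * Real.sin θ) (1, 0) +
        Real.sin θ * fderiv ℝ h (r * Real.cos θ, r * Real.sin θ) (0, 1) := by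
      have : g (r, θ) = fderiv ℝ h (r * Real.cos θ, r * Real.sin θ) (Real.cos θ, Real.sin θ) := by
        simp [hg]
      rw [this]
      conv_lhs => rw [hv, map_add, map_smul, map_smul]
      rfl
    have hps : polarCoord.symm (r, θ) = (r * Real.cos θ, r * Real.sin θ) := rfl
    simp only [hps]
    rw [hgv]
    simp only [dG, GA, GB, smul_eq_mul]
    rw [hs]
    field_simp
    ring
  refine h1.trans ?_
  rw [integral_const_mul, Measure.volume_eq_prod, ← setIntegral_prod_swap, setIntegral_prod]
  · simp only [Prod.swap_prod_mk, hinner]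
    rw [setIntegral_const]
    simp [Measure.real]
    rw [ENNReal.toReal_ofReal (by positivity)]
    field_simp
    ring
  · rw [Measure.volume_eq_prod] at hgi
    exact hgi.swap

lemma laplace {h : ℝ × ℝ → ℝ} (hh : ContDiff ℝ 2 h) (hc : HasCompactSupport h) :
    (∫ y, GL2 y * fderiv ℝ (fun z => fderiv ℝ h z (1, 0)) y (1, 0)) +
    (∫ y, GL2 y * fderiv ℝ (fun z => fderiv ℝ h z (0, 1)) y (0, 1)) = - h 0 := by
  have key : ∀ e : ℝ × ℝ, ContDiff ℝ 1 (fun z => fderiv ℝ h z e) := fun e =>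
    (hh.fderiv_right (m := 1) (by norm_num)).clm_apply contDiff_const
  have kc : ∀ e : ℝ × ℝ, HasCompactSupport (fun z => fderiv ℝ h z e) := fun e => hc.fderiv_apply ℝ e
  have i1 : ∀ e : ℝ × ℝ, Integrable (fun y => GL2 y * fderiv ℝ (fun z => fderiv ℝ h z e) y e) :=
    fun e => integrable_mul_of_compact locallyIntegrable_GL2
      (((key e).continuous_fderiv (by norm_num)).clm_apply continuous_const) ((kc e).fderiv_apply ℝ e)
  have i2 : ∀ e : ℝ × ℝ, Integrable (fun y => dG e y * fderiv ℝ h y e) :=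
    fun e => integrable_mul_of_compact (locallyIntegrable_dG e) (key e).continuous (kc e)
  have a1 := ibp1 (key (1, 0)) (kc (1, 0))
  have a2 := ibp2 (key (0, 1)) (kc (0, 1))
  have a3 := radial (hh.of_le (by norm_num)) hc
  rw [integral_add (i1 _) (i2 _)] at a1 a2
  rw [integral_add (i2 _) (i2 _)] at a3
  linarith

lemma conv_deriv {K k : ℝ × ℝ → ℝ} (hK : LocallyIntegrable K) (hk : ContDiff ℝ 1 k)
    (hc : HasCompactSupport k) (x₀ : ℝ × ℝ) :
    ∃ L : ℝ × ℝ →L[ℝ] ℝ, HasFDerivAt (fun x => ∫ y, K (x - y) * k y) L x₀ ∧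
      ∀ e, L e = ∫ y, K y * fderiv ℝ k (x₀ - y) e := by
  have h1 := hc.hasFDerivAt_convolution_right (ContinuousLinearMap.mul ℝ ℝ) hK hk x₀
  refine ⟨convolution K (fderiv ℝ k)
    (ContinuousLinearMap.precompR (ℝ × ℝ) (ContinuousLinearMap.mul ℝ ℝ)) volume x₀, ?_, ?_⟩
  · have h2 : (convolution K k (ContinuousLinearMap.mul ℝ ℝ) volume) =
      fun x => ∫ y, K (x - y) * k y := by
      funext x
      rw [convolution_def, ← integral_sub_left_eq_self _ _ x]
      simp
    rw [h2] at h1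
    exact h1
  · intro e
    rw [convolution_precompR_apply _ hK (hc.fderiv ℝ) (hk.continuous_fderiv (by norm_num))]
    rfl

lemma bdd_of_continuousOn {D : Set (ℝ × ℝ)} (hDb : Bornology.IsBounded D) {f : ℝ × ℝ → ℝ}
    (hf : ContinuousOn f (closure D)) : ∃ C, 0 ≤ C ∧ ∀ y ∈ D, |f y| ≤ C := by
  obtain ⟨C, hC⟩ := hDb.isCompact_closure.exists_bound_of_continuousOn hf
  exact ⟨|C|, abs_nonneg _, fun y hy => (hC y (subset_closure hy)).trans (le_abs_self _)⟩

lemma smooth_deriv {D : Set (ℝ × ℝ)} (hD : IsOpen D) (hDb : Bornology.IsBounded D)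
    {η f : ℝ × ℝ → ℝ} (hη : ContDiff ℝ 2 η) (h01 : ∀ y, 0 ≤ η y ∧ η y ≤ 1)
    (hf : ContinuousOn f (closure D)) (x₀ : ℝ × ℝ) {r : ℝ} (hr : 0 < r)
    (h1 : ∀ y ∈ Metric.ball x₀ r, η y = 1) (e : ℝ × ℝ) :
    ∃ L : ℝ × ℝ →L[ℝ] ℝ,
      HasFDerivAt (fun x => ∫ y in D, (1 - η y) * dG e (x - y) * f y) L x₀ ∧
      ∀ e', L e' = ∫ y in D, (1 - η y) * fderiv ℝ (dG e) (x₀ - y) e' * f y := by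
  obtain ⟨M, hM0, hM⟩ := bdd_of_continuousOn hDb hf
  have hvol : volume D < ⊤ := hDb.measure_lt_top
  have : IsFiniteMeasure (volume.restrict D) := ⟨by simpa using hvol⟩
  have hfm : AEStronglyMeasurable f (volume.restrict D) :=
    (hf.mono subset_closure).aestronglyMeasurable hD.measurableSet
  have hηm : AEStronglyMeasurable (fun y => 1 - η y) (volume.restrict D) :=
    (continuous_const.sub hη.continuous).aestronglyMeasurable
  obtain ⟨R, hR⟩ := hDb.subset_closedBall x₀
  -- the annulus
  set A : Set (ℝ × ℝ) := Metric.closedBall 0 (R + r) \ Metric.ball 0 (r / 2) with hA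
  have hAc : IsCompact A := (isCompact_closedBall _ _).diff Metric.isOpen_ball
  have hA0 : ∀ z ∈ A, z ≠ 0 := by
    rintro z hz rfl
    exact hz.2 (Metric.mem_ball_self (by positivity))
  have hcont : ∀ z ∈ A, ContinuousAt (fderiv ℝ (dG e)) z := fun z hz =>
    ((contDiffAt_dG e (n := 2) (hA0 z hz)).fderiv_right (m := 1) (by norm_num)).continuousAt
  obtain ⟨C₀, hC₀⟩ := hAc.exists_bound_of_continuousOn
    (f := fderiv ℝ (dG e)) (fun z hz => (hcont z hz).continuousWithinAt)
  obtain ⟨C₁, hC₁⟩ := hAc.exists_bound_of_continuousOn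
    (f := dG e) (fun z hz => (contDiffAt_dG e (n := 1) (hA0 z hz)).continuousAt.continuousWithinAt)
  have hmem : ∀ y ∈ D, y ∉ Metric.ball x₀ r → ∀ x ∈ Metric.ball x₀ (r / 2), x - y ∈ A := by
    intro y hy hyb x hx
    have hyR := hR hy
    rw [Metric.mem_closedBall] at hyR
    rw [Metric.mem_ball, not_lt] at hyb
    rw [Metric.mem_ball] at hx
    have t1 := dist_triangle x x₀ y
    have t2 := dist_triangle y x x₀
    rw [dist_comm x₀ y] at t1
    rw [dist_comm y x] at t2
    refine ⟨?_, ?_⟩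
    · rw [mem_closedBall_zero_iff, ← dist_eq_norm]; linarith
    · rw [mem_ball_zero_iff, ← dist_eq_norm, not_lt]; linarith
  have habs : ∀ y, |1 - η y| ≤ 1 := fun y =>
    abs_le.2 ⟨by linarith [(h01 y).2], by linarith [(h01 y).1]⟩
  set F' : ℝ × ℝ → ℝ × ℝ → (ℝ × ℝ →L[ℝ] ℝ) :=
    fun x y => ((1 - η y) * f y) • fderiv ℝ (dG e) (x - y) with hF'
  have hF'm : AEStronglyMeasurable (F' x₀) (volume.restrict D) := by
    refine (hηm.mul hfm).smul ?_
    exact ((measurable_fderiv ℝ (dG e)).comp (measurable_const.sub measurable_id)).aestronglyMeasurable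
  have hbound : ∀ y ∈ D, ∀ x ∈ Metric.ball x₀ (r / 2), ‖F' x y‖ ≤ M * |C₀| := by
    intro y hy x hx
    by_cases hyb : y ∈ Metric.ball x₀ r
    · simp only [hF', h1 y hyb]
      simp
      positivity
    · have := hC₀ _ (hmem y hy hyb x hx)
      simp only [hF', norm_smul, norm_mul, Real.norm_eq_abs]
      have hh := hM y hy
      calc _ ≤ (1 * M) * |C₀| := by
            gcongr
            · exact habs y
            · exact this.trans (le_abs_self _)
        _ = _ := by ring
  have hF'i : Integrable (F' x₀) (volume.restrict D) := by
    refine Integrable.of_bound hF'm (M * |C₀|) ?_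
    filter_upwards [ae_restrict_mem hD.measurableSet] with y hy
    exact hbound y hy x₀ (Metric.mem_ball_self (by positivity))
  have hmeas : ∀ x, AEStronglyMeasurable (fun y => (1 - η y) * dG e (x - y) * f y)
      (volume.restrict D) := fun x =>
    (hηm.mul ((measurable_dG e).comp (measurable_const.sub measurable_id)).aestronglyMeasurable).mul hfm
  refine ⟨∫ y in D, F' x₀ y, ?_, ?_⟩
  · refine hasFDerivAt_integral_of_dominated_of_fderiv_le
      (Metric.ball_mem_nhds x₀ (half_pos hr)) (Eventually.of_forall hmeas) ?_ hF'm
      (bound := fun _ => M * |C₀|) ?_ (integrable_const _) ?_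
    · refine Integrable.of_bound (hmeas x₀) (|C₁| * M) ?_
      filter_upwards [ae_restrict_mem hD.measurableSet] with y hy
      by_cases hyb : y ∈ Metric.ball x₀ r
      · simp only [h1 y hyb]
        simp
        positivity
      · have := hC₁ _ (hmem y hy hyb x₀ (Metric.mem_ball_self (by positivity)))
        simp only [norm_mul, Real.norm_eq_abs] at this ⊢
        have hh := hM y hy
        have ht := this.trans (le_abs_self _)
        calc _ ≤ (1 * |C₁|) * M :=
              mul_le_mul (mul_le_mul (habs y) ht (abs_nonneg _) zero_le_one) hh (abs_nonneg _)
                (by positivity)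
          _ = _ := by ring
    · filter_upwards [ae_restrict_mem hD.measurableSet] with y hy
      exact hbound y hy
    · filter_upwards [ae_restrict_mem hD.measurableSet] with y hy x hx
      by_cases hyb : y ∈ Metric.ball x₀ r
      · simp only [hF', h1 y hyb]
        simpa using hasFDerivAt_const (0 : ℝ) x
      · have hz := hA0 _ (hmem y hy hyb x hx)
        have hd : HasFDerivAt (dG e) (fderiv ℝ (dG e) (x - y)) (x - y) :=
          ((contDiffAt_dG e (n := 1) hz).differentiableAt (by norm_num)).hasFDerivAt
        have hd2 : HasFDerivAt (fun x => dG e (x - y)) (fderiv ℝ (dG e) (x - y)) x :=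
          (hasFDerivAt_comp_sub (f := dG e) y).2 hd
        have hd3 := hd2.const_mul ((1 - η y) * f y)
        refine hd3.congr_of_eventuallyEq (Eventually.of_forall fun x => ?_)
        simp only
        ring
  · intro e'
    rw [ContinuousLinearMap.integral_apply hF'i]
    congr 1
    funext y
    simp [hF']
    ring

lemma fderiv_bdd {D : Set (ℝ × ℝ)} (hD : IsOpen D) (hDb : Bornology.IsBounded D) {f : ℝ × ℝ → ℝ}
    (hf : ContDiffOn ℝ 1 f (closure D)) : ∃ C, ∀ y ∈ D, ‖fderiv ℝ f y‖ ≤ C := by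
  have := hDb.isCompact_closure.induction_on
    (p := fun s => ∃ C, ∀ y ∈ s ∩ D, ‖fderiv ℝ f y‖ ≤ C) ?_ ?_ ?_ ?_
  · obtain ⟨C, hC⟩ := this
    exact ⟨C, fun y hy => hC y ⟨subset_closure hy, hy⟩⟩
  · exact ⟨0, by simp⟩
  · rintro s t hst ⟨C, hC⟩
    exact ⟨C, fun y hy => hC y ⟨hst hy.1, hy.2⟩⟩
  · rintro s t ⟨C, hC⟩ ⟨C', hC'⟩
    refine ⟨max C C', ?_⟩
    rintro y ⟨hy | hy, hyD⟩
    · exact (hC y ⟨hy, hyD⟩).trans (le_max_left _ _)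
    · exact (hC' y ⟨hy, hyD⟩).trans (le_max_right _ _)
  · intro x hx
    have h1 : ContDiffWithinAt ℝ (0 + 1) f (closure D) x := by simpa using hf x hx
    rw [contDiffWithinAt_succ_iff_hasFDerivWithinAt (by simp)] at h1
    obtain ⟨u, hu, -, f', hf', hc⟩ := h1
    rw [insert_eq_of_mem hx] at hu
    have hcont : ContinuousWithinAt f' u x := hc.continuousWithinAt
    have hb : ∀ᶠ y in 𝓝[u] x, ‖f' y‖ < ‖f' x‖ + 1 :=
      hcont.norm.eventually (gt_mem_nhds (lt_add_one _))
    have hb2 : ∀ᶠ y in 𝓝[closure D] x, ‖f' y‖ < ‖f' x‖ + 1 :=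
      hb.filter_mono (nhdsWithin_le_of_mem hu)
    obtain ⟨O, hO, hxO, hOu⟩ := mem_nhdsWithin.1 hu
    refine ⟨_, inter_mem hb2 (inter_mem hu (inter_mem_nhdsWithin _ (hO.mem_nhds hxO))), ‖f' x‖ + 1, ?_⟩
    rintro y ⟨⟨hy1, hy2, hy3, hy4⟩, hyD⟩
    have hun : u ∈ 𝓝 y := by
      filter_upwards [hO.mem_nhds hy4, hD.mem_nhds hyD] with z a b
      exact hOu ⟨a, subset_closure b⟩
    rw [((hf' y hy2).hasFDerivAt hun).fderiv]
    exact le_of_lt hy1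

lemma integrableOn_kernel {D : Set (ℝ × ℝ)} (hD : IsOpen D) (hDb : Bornology.IsBounded D)
    {K g : ℝ × ℝ → ℝ} (hK : LocallyIntegrable K)
    (hg : AEStronglyMeasurable g (volume.restrict D)) {C : ℝ} (hC : ∀ y ∈ D, |g y| ≤ C)
    (x : ℝ × ℝ) : IntegrableOn (fun y => K (x - y) * g y) D := by
  have h1 : IntegrableOn (fun y => K (x - y)) D := by
    have hcomp : IsCompact ((fun y => x - y) '' closure D) :=
      hDb.isCompact_closure.image (by fun_prop)
    have h2 := (hK.integrableOn_isCompact hcomp)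
    have h3 := ((Measure.measurePreserving_sub_left volume x).integrableOn_comp_preimage
      (MeasurableEquiv.subLeft x).measurableEmbedding).2 h2
    exact h3.mono_set (fun y hy => mem_image_of_mem _ (subset_closure hy))
  refine Integrable.mul_bdd (c := C) h1 hg ?_
  filter_upwards [ae_restrict_mem hD.measurableSet] with y hy
  exact hC y hy

/-- the volume potential obtained after removing the boundary term -/
noncomputable def QQ (D : Set (ℝ × ℝ)) (η : ℝ × ℝ → ℝ) (e : ℝ × ℝ) (f : ℝ × ℝ → ℝ)
    (x : ℝ × ℝ) : ℝ :=
  (∫ y, GL2 (x - y) * fderiv ℝ (fun z => η z * f z) y e) +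
    ∫ y in D, (1 - η y) * dG e (x - y) * f y

/-- its derivatives -/
noncomputable def qq (D : Set (ℝ × ℝ)) (η : ℝ × ℝ → ℝ) (x₀ e : ℝ × ℝ) (f : ℝ × ℝ → ℝ)
    (e' : ℝ × ℝ) : ℝ :=
  (∫ y, GL2 y * fderiv ℝ (fun z => fderiv ℝ (fun z => η z * f z) z e) (x₀ - y) e') +
    ∫ y in D, (1 - η y) * fderiv ℝ (dG e) (x₀ - y) e' * f y

lemma contDiff_cut {D : Set (ℝ × ℝ)} (hD : IsOpen D) {η f : ℝ × ℝ → ℝ} (hη : ContDiff ℝ 2 η)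
    (hs : tsupport η ⊆ D) (hf : ContDiffOn ℝ 2 f (closure D)) :
    ContDiff ℝ 2 (fun z => η z * f z) := by
  rw [contDiff_iff_contDiffAt]
  intro y
  by_cases hy : y ∈ tsupport η
  · exact hη.contDiffAt.mul
      (hf.contDiffAt (mem_of_superset (hD.mem_nhds (hs hy)) subset_closure))
  · have h0 := notMem_tsupport_iff_eventuallyEq.1 hy
    have : (fun z => η z * f z) =ᶠ[𝓝 y] fun _ => 0 := by
      filter_upwards [h0] with z hz
      simp [hz]
    exact contDiffAt_const.congr_of_eventuallyEq this

lemma QQ_deriv {D : Set (ℝ × ℝ)} (hD : IsOpen D) (hDb : Bornology.IsBounded D)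
    {η f : ℝ × ℝ → ℝ} (hη : ContDiff ℝ 2 η) (h01 : ∀ y, 0 ≤ η y ∧ η y ≤ 1)
    (hηc : HasCompactSupport η) (hs : tsupport η ⊆ D)
    (hf : ContDiffOn ℝ 2 f (closure D)) (x₀ : ℝ × ℝ) {r : ℝ} (hr : 0 < r)
    (h1 : ∀ y ∈ Metric.ball x₀ r, η y = 1) (e : ℝ × ℝ) :
    ∃ L : ℝ × ℝ →L[ℝ] ℝ, HasFDerivAt (QQ D η e f) L x₀ ∧ ∀ e', L e' = qq D η x₀ e f e' := by
  have hh := contDiff_cut hD hη hs hf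
  have hhc : HasCompactSupport (fun z => η z * f z) := hηc.mul_right
  obtain ⟨L1, d1, v1⟩ := conv_deriv locallyIntegrable_GL2
    (k := fun z => fderiv ℝ (fun z => η z * f z) z e)
    ((hh.fderiv_right (m := 1) (by norm_num)).clm_apply contDiff_const) (hhc.fderiv_apply ℝ e) x₀
  obtain ⟨L2, d2, v2⟩ := smooth_deriv hD hDb hη h01 hf.continuousOn x₀ hr h1 e
  refine ⟨L1 + L2, d1.add d2, ?_⟩
  intro e'
  rw [_root_.add_apply, v1, v2]
  rfl

lemma qq_symm {D : Set (ℝ × ℝ)} (hD : IsOpen D)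
    {η f : ℝ × ℝ → ℝ} (hη : ContDiff ℝ 2 η) (hs : tsupport η ⊆ D)
    (hf : ContDiffOn ℝ 2 f (closure D)) (x₀ : ℝ × ℝ) (h1 : η x₀ = 1) (e e' : ℝ × ℝ) :
    qq D η x₀ e f e' = qq D η x₀ e' f e := by
  have hh := contDiff_cut hD hη hs hf
  unfold qq
  congr 1
  · congr 1
    funext y
    have key : ∀ e e' : ℝ × ℝ, fderiv ℝ (fun z => fderiv ℝ (fun z => η z * f z) z e) (x₀ - y) e' =
        fderiv ℝ (fderiv ℝ (fun z => η z * f z)) (x₀ - y) e' e := by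
      intro e e'
      have h2 : DifferentiableAt ℝ (fderiv ℝ (fun z => η z * f z)) (x₀ - y) :=
        (hh.fderiv_right (m := 1) (by norm_num)).contDiffAt.differentiableAt (by norm_num)
      rw [fderiv_clm_apply h2 (differentiableAt_const e)]
      simp
    rw [key, key, (hh.contDiffAt.isSymmSndFDerivAt (by simp)) e' e]
  · congr 1
    funext y
    by_cases hy : y = x₀
    · simp [hy, h1]
    · rw [dG_symm e e' (sub_ne_zero.2 (Ne.symm hy))]

lemma fderiv_refl {k : ℝ × ℝ → ℝ} (hk : ContDiff ℝ 1 k) (x₀ y e : ℝ × ℝ) :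
    fderiv ℝ (fun z => k (x₀ - z)) y e = - fderiv ℝ k (x₀ - y) e := by
  have h1 : HasFDerivAt k (fderiv ℝ k (x₀ - y)) (x₀ - y) :=
    (hk.contDiffAt.differentiableAt (by norm_num)).hasFDerivAt
  have h2 : HasFDerivAt (fun z : ℝ × ℝ => x₀ - z) (-ContinuousLinearMap.id ℝ (ℝ × ℝ)) y :=
    (hasFDerivAt_id y).const_sub x₀
  have h3 : HasFDerivAt (fun z => k (x₀ - z)) _ y := h1.comp y h2
  rw [h3.fderiv]
  simp

lemma qq_trace {D : Set (ℝ × ℝ)} (hD : IsOpen D)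
    {η f : ℝ × ℝ → ℝ} (hη : ContDiff ℝ 2 η) (hηc : HasCompactSupport η) (hs : tsupport η ⊆ D)
    (hf : ContDiffOn ℝ 2 f (closure D)) (x₀ : ℝ × ℝ) (h1 : η x₀ = 1) :
    qq D η x₀ (1, 0) f (1, 0) + qq D η x₀ (0, 1) f (0, 1) = - f x₀ := by
  have hh := contDiff_cut hD hη hs hf
  have hhc : HasCompactSupport (fun z => η z * f z) := hηc.mul_right
  have hl := laplace (h := fun z => (fun z => η z * f z) (x₀ - z))
    (hh.comp (contDiff_const.sub contDiff_id))
    (hhc.comp_homeomorph (Homeomorph.subLeft x₀))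
  have key : ∀ e y : ℝ × ℝ,
      fderiv ℝ (fun z => fderiv ℝ (fun z => (fun z => η z * f z) (x₀ - z)) z e) y e =
      fderiv ℝ (fun z => fderiv ℝ (fun z => η z * f z) z e) (x₀ - y) e := by
    intro e y
    have a : (fun z => fderiv ℝ (fun z => (fun z => η z * f z) (x₀ - z)) z e) =
        fun z => (fun w => - fderiv ℝ (fun z => η z * f z) w e) (x₀ - z) := by
      funext z
      exact fderiv_refl (hh.of_le (by norm_num)) x₀ z e
    have c1 : ContDiff ℝ 1 (fun w => - fderiv ℝ (fun z => η z * f z) w e) :=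
      ((hh.fderiv_right (m := 1) (by norm_num)).clm_apply contDiff_const).neg
    rw [a, fderiv_refl c1, fderiv_fun_neg]
    simp
  simp only [key] at hl
  have h2 : ∫ y in D, (1 - η y) * fderiv ℝ (dG (0, 1)) (x₀ - y) (0, 1) * f y =
      -∫ y in D, (1 - η y) * fderiv ℝ (dG (1, 0)) (x₀ - y) (1, 0) * f y := by
    rw [← integral_neg]
    congr 1
    funext y
    by_cases hy : y = x₀
    · simp [hy, h1]
    · have := dG_trace (sub_ne_zero.2 (Ne.symm hy) : x₀ - y ≠ 0)
      rw [eq_neg_of_add_eq_zero_right this]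
      ring
  unfold qq
  rw [h2]
  simp only [sub_zero, h1, one_mul] at hl
  linarith

lemma QQ_neg (D : Set (ℝ × ℝ)) (η : ℝ × ℝ → ℝ) (e : ℝ × ℝ) (f : ℝ × ℝ → ℝ) (x : ℝ × ℝ) :
    QQ D η e (fun z => - f z) x = - QQ D η e f x := by
  unfold QQ
  simp only [mul_neg, fderiv_fun_neg, _root_.neg_apply, integral_neg]
  ring

lemma hasDerivAt_fst_line {f : ℝ × ℝ → ℝ} {L : ℝ × ℝ →L[ℝ] ℝ} {y : ℝ × ℝ} (h : HasFDerivAt f L y) :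
    pdx f y = L (1, 0) := by
  have h1 : HasDerivAt (fun a : ℝ => (a, y.2)) ((1, 0) : ℝ × ℝ) y.1 :=
    (hasDerivAt_id y.1).prodMk (hasDerivAt_const y.1 y.2)
  exact (HasFDerivAt.comp_hasDerivAt (l := f) y.1 h h1).deriv

lemma hasDerivAt_snd_line {f : ℝ × ℝ → ℝ} {L : ℝ × ℝ →L[ℝ] ℝ} {y : ℝ × ℝ} (h : HasFDerivAt f L y) :
    pdy f y = L (0, 1) := by
  have h1 : HasDerivAt (fun a : ℝ => (y.1, a)) ((0, 1) : ℝ × ℝ) y.2 :=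
    (hasDerivAt_const y.2 y.1).prodMk (hasDerivAt_id y.2)
  exact (HasFDerivAt.comp_hasDerivAt (l := f) y.2 h h1).deriv

lemma cut_kernel {η : ℝ × ℝ → ℝ} (hη : ContDiff ℝ 2 η) {x₀ : ℝ × ℝ} {r : ℝ}
    (h1 : ∀ y ∈ Metric.ball x₀ r, η y = 1) {x : ℝ × ℝ} (hx : x ∈ Metric.ball x₀ r) :
    ContDiff ℝ 1 (fun y => (1 - η y) * GL2 (x - y)) ∧
    ∀ y e, fderiv ℝ (fun y => (1 - η y) * GL2 (x - y)) y e =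
      -(fderiv ℝ η y e) * GL2 (x - y) - (1 - η y) * dG e (x - y) := by
  have hG : ∀ y, y ≠ x → ContDiffAt ℝ 1 (fun y => GL2 (x - y)) y := fun y hy =>
    ContDiffAt.comp y (g := GL2) (contDiffAt_GL2 (sub_ne_zero.2 (Ne.symm hy)))
      (contDiffAt_const.sub contDiffAt_id)
  have hη1 : ContDiff ℝ 1 (fun y => 1 - η y) := contDiff_const.sub (hη.of_le (by norm_num))
  have hev : η =ᶠ[𝓝 x] fun _ => 1 := by
    filter_upwards [Metric.isOpen_ball.mem_nhds hx] with z hz using h1 z hz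
  have hev2 : (fun y => (1 - η y) * GL2 (x - y)) =ᶠ[𝓝 x] fun _ => 0 := by
    filter_upwards [hev] with z hz
    simp [hz]
  constructor
  · rw [contDiff_iff_contDiffAt]
    intro y
    by_cases hy : y = x
    · subst hy
      exact contDiffAt_const.congr_of_eventuallyEq hev2
    · exact hη1.contDiffAt.mul (hG y hy)
  · intro y e
    by_cases hy : y = x
    · subst hy
      rw [hev2.fderiv_eq, hev.fderiv_eq, h1 y hx]
      simp
    · have d1 : DifferentiableAt ℝ (fun y => 1 - η y) y :=
        hη1.contDiffAt.differentiableAt (by norm_num)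
      have d2 := (hG y hy).differentiableAt (by norm_num)
      have hz : x - y ≠ 0 := sub_ne_zero.2 (Ne.symm hy)
      have d3 : HasFDerivAt GL2 (fderiv ℝ GL2 (x - y)) (x - y) :=
        ((contDiffAt_GL2 (n := 1) hz).differentiableAt (by norm_num)).hasFDerivAt
      have d4 : HasFDerivAt (fun z : ℝ × ℝ => x - z) (-ContinuousLinearMap.id ℝ (ℝ × ℝ)) y :=
        (hasFDerivAt_id y).const_sub x
      have d5 : HasFDerivAt (fun z => GL2 (x - z)) _ y := d3.comp y d4
      rw [fderiv_fun_mul d1 d2, d5.fderiv, fderiv_const_sub]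
      simp [fderiv_GL2 hz]
      ring

lemma decomp {D : Set (ℝ × ℝ)} (hD : IsOpen D) (hDb : Bornology.IsBounded D)
    (σ : Measure (ℝ × ℝ)) (ν : ℝ × ℝ → ℝ × ℝ)
    (hdivthm : ∀ G : ℝ × ℝ → ℝ × ℝ, ContDiffOn ℝ 1 G (closure D) →
      ∫ y in D, (pdx (fun z => (G z).1) y + pdy (fun z => (G z).2) y) =
        ∫ y in frontier D, ((G y).1 * (ν y).1 + (G y).2 * (ν y).2) ∂σ)
    {η f g : ℝ × ℝ → ℝ} (hη : ContDiff ℝ 2 η) (h01 : ∀ y, 0 ≤ η y ∧ η y ≤ 1)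
    (hηc : HasCompactSupport η) (hs : tsupport η ⊆ D)
    (hf : ContDiffOn ℝ 2 f (closure D)) (hg : ContDiffOn ℝ 2 g (closure D))
    {x₀ : ℝ × ℝ} {r : ℝ} (h1 : ∀ y ∈ Metric.ball x₀ r, η y = 1)
    {x : ℝ × ℝ} (hx : x ∈ Metric.ball x₀ r) :
    -(∫ y in D, GL2 (x - y) * (pdx f y + pdy g y)) +
      ∫ y in frontier D, GL2 (x - y) * ((ν y).1 * f y + (ν y).2 * g y) ∂σ =
    -(QQ D η (1, 0) f x + QQ D η (0, 1) g x) := by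
  obtain ⟨hw, hdw⟩ := cut_kernel hη h1 hx
  set w : ℝ × ℝ → ℝ := fun y => (1 - η y) * GL2 (x - y) with hwdef
  have hbd : ∫ y in frontier D, GL2 (x - y) * ((ν y).1 * f y + (ν y).2 * g y) ∂σ =
      ∫ y in D, (pdx (fun z => w z * f z) y + pdy (fun z => w z * g z) y) := by
    rw [hdivthm (fun z => (w z * f z, w z * g z))
      ((hw.contDiffOn.mul (hf.of_le (by norm_num))).prodMk
        (hw.contDiffOn.mul (hg.of_le (by norm_num))))]
    apply setIntegral_congr_fun isClosed_frontier.measurableSet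
    intro y hy
    have hyD : y ∉ D := by
      rw [hD.frontier_eq] at hy
      exact hy.2
    have hy0 : η y = 0 := image_eq_zero_of_notMem_tsupport (fun h => hyD (hs h))
    simp only [hwdef, hy0]
    ring
  have hdiff : ∀ {f : ℝ × ℝ → ℝ}, ContDiffOn ℝ 2 f (closure D) → ∀ y ∈ D, DifferentiableAt ℝ f y :=
    fun {f} hf y hy => (hf.contDiffAt
      (mem_of_superset (hD.mem_nhds hy) subset_closure)).differentiableAt (by norm_num)
  have ηd : ∀ y, DifferentiableAt ℝ η y := fun y => hη.contDiffAt.differentiableAt (by norm_num)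
  have wd : ∀ y, DifferentiableAt ℝ w y := fun y => hw.contDiffAt.differentiableAt (by norm_num)
  -- pointwise identity
  have hpt : ∀ {f : ℝ × ℝ → ℝ}, ContDiffOn ℝ 2 f (closure D) → ∀ e, ∀ y ∈ D,
      fderiv ℝ (fun z => w z * f z) y e = GL2 (x - y) * fderiv ℝ f y e -
        GL2 (x - y) * fderiv ℝ (fun z => η z * f z) y e - (1 - η y) * dG e (x - y) * f y := by
    intro f hf e y hy
    rw [fderiv_fun_mul (wd y) (hdiff hf y hy), fderiv_fun_mul (ηd y) (hdiff hf y hy)]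
    simp only [_root_.add_apply, _root_.smul_apply, smul_eq_mul, hdw]
    simp only [hwdef]
    ring
  have ia : ∀ {f : ℝ × ℝ → ℝ}, ContDiffOn ℝ 2 f (closure D) → ∀ e,
      IntegrableOn (fun y => GL2 (x - y) * fderiv ℝ f y e) D := by
    intro f hf e
    obtain ⟨C, hC⟩ := fderiv_bdd hD hDb (hf.of_le (by norm_num))
    refine integrableOn_kernel hD hDb locallyIntegrable_GL2
      (measurable_fderiv_apply_const ℝ f e).aestronglyMeasurable (C := C * ‖e‖) ?_ x
    intro y hy
    exact (ContinuousLinearMap.le_opNorm _ _).trans (mul_le_mul_of_nonneg_right (hC y hy) (norm_nonneg e))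
  have ic : ∀ {f : ℝ × ℝ → ℝ}, ContDiffOn ℝ 2 f (closure D) → ∀ e,
      IntegrableOn (fun y => GL2 (x - y) * fderiv ℝ (fun z => η z * f z) y e) D :=
    fun {f} hf e => ia (contDiff_cut hD hη hs hf).contDiffOn e
  have id' : ∀ {f : ℝ × ℝ → ℝ}, ContDiffOn ℝ 2 f (closure D) → ∀ e,
      IntegrableOn (fun y => (1 - η y) * dG e (x - y) * f y) D := by
    intro f hf e
    have hcont : ContinuousOn (fun y => (1 - η y) * f y) (closure D) :=
      (continuous_const.sub hη.continuous).continuousOn.mul hf.continuousOn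
    obtain ⟨C, -, hC⟩ := bdd_of_continuousOn hDb hcont
    have := integrableOn_kernel hD hDb (locallyIntegrable_dG e)
      ((hcont.mono subset_closure).aestronglyMeasurable hD.measurableSet) hC x
    refine this.congr (Eventually.of_forall fun y => ?_)
    simp only
    ring
  have ifull : ∀ {f : ℝ × ℝ → ℝ}, ∀ e,
      ∫ y in D, GL2 (x - y) * fderiv ℝ (fun z => η z * f z) y e =
      ∫ y, GL2 (x - y) * fderiv ℝ (fun z => η z * f z) y e := by
    intro f e
    apply setIntegral_eq_integral_of_forall_compl_eq_zero
    intro y hy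
    have h0 := notMem_tsupport_iff_eventuallyEq.1 (fun h => hy (hs h))
    have : (fun z => η z * f z) =ᶠ[𝓝 y] fun _ => 0 := by
      filter_upwards [h0] with z hz
      simp [hz]
    rw [this.fderiv_eq]
    simp
  have hone : ∀ {f : ℝ × ℝ → ℝ}, ContDiffOn ℝ 2 f (closure D) → ∀ e,
      IntegrableOn (fun y => fderiv ℝ (fun z => w z * f z) y e) D ∧
      ∫ y in D, fderiv ℝ (fun z => w z * f z) y e =
        (∫ y in D, GL2 (x - y) * fderiv ℝ f y e) - QQ D η e f x := by
    intro f hf e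
    have hi := ((ia hf e).sub (ic hf e)).sub (id' hf e)
    constructor
    · exact IntegrableOn.congr_fun hi (fun y hy => (hpt hf e y hy).symm) hD.measurableSet
    · have hi2 : IntegrableOn (fun y => GL2 (x - y) * fderiv ℝ f y e -
          GL2 (x - y) * fderiv ℝ (fun z => η z * f z) y e) D := (ia hf e).sub (ic hf e)
      rw [setIntegral_congr_fun hD.measurableSet (hpt hf e),
        integral_sub hi2 (id' hf e), integral_sub (ia hf e) (ic hf e), ifull]
      unfold QQ
      ring
  have e1 : ∫ y in D, (pdx (fun z => w z * f z) y + pdy (fun z => w z * g z) y) =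
      ∫ y in D, (fderiv ℝ (fun z => w z * f z) y (1, 0) + fderiv ℝ (fun z => w z * g z) y (0, 1)) := by
    apply setIntegral_congr_fun hD.measurableSet
    intro y hy
    simp only
    rw [hasDerivAt_fst_line ((wd y).fun_mul (hdiff hf y hy)).hasFDerivAt,
      hasDerivAt_snd_line ((wd y).fun_mul (hdiff hg y hy)).hasFDerivAt]
  have e2 : ∫ y in D, GL2 (x - y) * (pdx f y + pdy g y) =
      ∫ y in D, (GL2 (x - y) * fderiv ℝ f y (1, 0) + GL2 (x - y) * fderiv ℝ g y (0, 1)) := by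
    apply setIntegral_congr_fun hD.measurableSet
    intro y hy
    simp only
    rw [hasDerivAt_fst_line (hdiff hf y hy).hasFDerivAt,
      hasDerivAt_snd_line (hdiff hg y hy).hasFDerivAt]
    ring
  rw [hbd, e1, e2, integral_add (ia hf _) (ia hg _), integral_add (hone hf _).1 (hone hg _).1,
    (hone hf _).2, (hone hg _).2]
  ring

/-- the explicit 2D Helmholtz decomposition `F = ∇^⊥ψ + ∇φ` in a bounded
smooth domain `D ⊂ ℝ²`; the arclength measure `σ`, outward normal `ν` and unit tangent
`τ = ν^⊥` on `Γ = ∂D` are characterized by the divergence theorem hypothesis `hdivthm`. -/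
theorem helmholtz_decomposition_2d
    (D : Set (ℝ × ℝ)) (hD : IsOpen D) (hDb : Bornology.IsBounded D)
    (σ : Measure (ℝ × ℝ)) [IsFiniteMeasure σ]
    (ν τ : ℝ × ℝ → ℝ × ℝ)
    (hτ : ∀ y ∈ frontier D, τ y = (-(ν y).2, (ν y).1))
    (hdivthm : ∀ G : ℝ × ℝ → ℝ × ℝ, ContDiffOn ℝ 1 G (closure D) →
      ∫ y in D, (pdx (fun z => (G z).1) y + pdy (fun z => (G z).2) y) =
        ∫ y in frontier D, ((G y).1 * (ν y).1 + (G y).2 * (ν y).2) ∂σ)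
    (F : ℝ × ℝ → ℝ × ℝ) (hF : ContDiffOn ℝ 2 F (closure D))
    (φ : ℝ × ℝ → ℝ)
    (hφ : ∀ x, φ x =
      -(∫ y in D, GL2 (x - y) * (pdx (fun z => (F z).1) y + pdy (fun z => (F z).2) y)) +
        ∫ y in frontier D, GL2 (x - y) * ((ν y).1 * (F y).1 + (ν y).2 * (F y).2) ∂σ)
    (ψ : ℝ × ℝ → ℝ)
    (hψ : ∀ x, ψ x =
      (∫ y in D, GL2 (x - y) * (pdx (fun z => (F z).2) y - pdy (fun z => (F z).1) y)) -
        ∫ y in frontier D, GL2 (x - y) * ((τ y).1 * (F y).1 + (τ y).2 * (F y).2) ∂σ) :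
    ∀ x ∈ D, F x = (pdy ψ x + pdx φ x, -(pdx ψ x) + pdy φ x) := by
  intro x₀ hx₀
  obtain ⟨R, hR, hRD⟩ := Metric.nhds_basis_closedBall.mem_iff.1 (hD.mem_nhds hx₀)
  let b : ContDiffBump x₀ := ⟨R / 2, R, by positivity, by linarith⟩
  have hη : ContDiff ℝ 2 b := b.contDiff
  have h01 : ∀ y, 0 ≤ b y ∧ b y ≤ 1 := fun y => ⟨b.nonneg, b.le_one⟩
  have hηc : HasCompactSupport b := b.hasCompactSupport
  have hs : tsupport b ⊆ D := by rw [b.tsupport_eq]; exact hRD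
  have hr : 0 < R / 2 := by positivity
  have h1 : ∀ y ∈ Metric.ball x₀ (R / 2), b y = 1 := fun y hy =>
    b.one_of_mem_closedBall (Metric.ball_subset_closedBall hy)
  have h1x : b x₀ = 1 := h1 x₀ (Metric.mem_ball_self hr)
  generalize (b : ℝ × ℝ → ℝ) = η at *
  have hf : ContDiffOn ℝ 2 (fun z => (F z).1) (closure D) := hF.fst
  have hg : ContDiffOn ℝ 2 (fun z => (F z).2) (closure D) := hF.snd
  set f : ℝ × ℝ → ℝ := fun z => (F z).1 with hfdef
  set g : ℝ × ℝ → ℝ := fun z => (F z).2 with hgdef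
  have hφe : φ =ᶠ[𝓝 x₀] fun x => -(QQ D η (1, 0) f x + QQ D η (0, 1) g x) := by
    filter_upwards [Metric.ball_mem_nhds x₀ hr] with x hx
    rw [hφ x]
    exact decomp hD hDb σ ν hdivthm hη h01 hηc hs hf hg h1 hx
  have hψe : ψ =ᶠ[𝓝 x₀] fun x => QQ D η (1, 0) g x - QQ D η (0, 1) f x := by
    filter_upwards [Metric.ball_mem_nhds x₀ hr] with x hx
    have hd := decomp hD hDb σ ν hdivthm hη h01 hηc hs hg hf.neg h1 hx
    rw [QQ_neg] at hd
    rw [hψ x]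
    have a1 : ∫ y in D, GL2 (x - y) * (pdx g y - pdy f y) =
        ∫ y in D, GL2 (x - y) * (pdx g y + pdy (fun z => -f z) y) := by
      congr 1
      funext y
      simp [pdy, sub_eq_add_neg]
    have a2 : ∫ y in frontier D, GL2 (x - y) * ((τ y).1 * (F y).1 + (τ y).2 * (F y).2) ∂σ =
        ∫ y in frontier D, GL2 (x - y) * ((ν y).1 * g y + (ν y).2 * (-f y)) ∂σ := by
      apply setIntegral_congr_fun isClosed_frontier.measurableSet
      intro y hy
      simp only [hτ y hy, hfdef, hgdef]
      ring
    rw [a1, a2]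
    linarith
  obtain ⟨L1, d1, v1⟩ := QQ_deriv hD hDb hη h01 hηc hs hf x₀ hr h1 (1, 0)
  obtain ⟨L2, d2, v2⟩ := QQ_deriv hD hDb hη h01 hηc hs hf x₀ hr h1 (0, 1)
  obtain ⟨M1, d3, w1⟩ := QQ_deriv hD hDb hη h01 hηc hs hg x₀ hr h1 (1, 0)
  obtain ⟨M2, d4, w2⟩ := QQ_deriv hD hDb hη h01 hηc hs hg x₀ hr h1 (0, 1)
  have dφ : HasFDerivAt φ (-(L1 + M2)) x₀ := (d1.add d4).neg.congr_of_eventuallyEq hφe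
  have dψ : HasFDerivAt ψ (M1 - L2) x₀ := (d3.sub d2).congr_of_eventuallyEq hψe
  have s1 := qq_symm hD hη hs hf x₀ h1x (1, 0) (0, 1)
  have s2 := qq_symm hD hη hs hg x₀ h1x (1, 0) (0, 1)
  have t1 := qq_trace hD hη hηc hs hf x₀ h1x
  have t2 := qq_trace hD hη hηc hs hg x₀ h1x
  rw [hasDerivAt_fst_line dφ, hasDerivAt_snd_line dφ, hasDerivAt_fst_line dψ, hasDerivAt_snd_line dψ]
  simp only [_root_.neg_apply, _root_.add_apply,
    _root_.sub_apply, v1, v2, w1, w2]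
  apply Prod.ext
  · change f x₀ = _
    simp only
    linarith
  · change g x₀ = _
    simp only
    linarith
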